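/- Let R^4 be the profile ≽_1: a,{b,c,d}; ≽_2: {b,d},a,c; ≽_3: a,d,{b,c}; ≽_4: {b,c},a,d, and let R^5 be obtained from R^4 by replacing agent 3's preference with ≽_3: a,{b,c,d}. Then f(R^5)(c) = f(R^5)(d) = 0, and if f(R^4)(a) > 1/2 then f(R^5)(a) > 1/2. -/

import Mathlib

open Finset
open scoped Classical

section Framework

variable {A : Type*} [Fintype A] {n : ℕ}

/-- `p` is a lottery (probability distribution) on the set of alternatives `A`. -/
def IsLottery (p : A → ℝ) : Prop := (∀ x, 0 ≤ p x) ∧ ∑ x, p x = 1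

/-- `r` is a weak preference relation: complete (total) and transitive. -/
def IsPref (r : A → A → Prop) : Prop := Total r ∧ Transitive r

/-- A preference profile assigns a weak preference relation to each of the `n` agents. -/
def IsProfile (R : Fin n → A → A → Prop) : Prop := ∀ i, IsPref (R i)

/-- The probability that `p` assigns to alternatives weakly preferred (by `r`) to `x`. -/
noncomputable def upperProb (r : A → A → Prop) (p : A → ℝ) (x : A) : ℝ :=
  ∑ y ∈ univ.filter (fun y => r y x), p y

/-- Stochastic dominance: `p ≽^sd q` w.r.t. the preference relation `r`. -/
def SDge (r : A → A → Prop) (p q : A → ℝ) : Prop :=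
  ∀ x, upperProb r q x ≤ upperProb r p x

/-- Strict stochastic dominance: `p ≻^sd q` w.r.t. the preference relation `r`. -/
def SDgt (r : A → A → Prop) (p q : A → ℝ) : Prop :=
  SDge r p q ∧ ¬ SDge r q p

/-- A social decision scheme maps every preference profile to a lottery. -/
def IsSDS (f : (Fin n → A → A → Prop) → (A → ℝ)) : Prop :=
  ∀ R : Fin n → A → A → Prop, IsProfile R → IsLottery (f R)

/-- Anonymity: invariance under permutations of the agents. -/
def Anonymous (f : (Fin n → A → A → Prop) → (A → ℝ)) : Prop :=
  ∀ R : Fin n → A → A → Prop, IsProfile R → ∀ π : Equiv.Perm (Fin n),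
    f (fun i => R (π i)) = f R

/-- Neutrality: `f(R^σ)(σ x) = f(R)(x)`, where `R^σ` relabels alternatives by `σ`
(i.e. `σ x ≽^σ_i σ y ↔ x ≽_i y`). -/
def Neutral (f : (Fin n → A → A → Prop) → (A → ℝ)) : Prop :=
  ∀ R : Fin n → A → A → Prop, IsProfile R → ∀ σ : Equiv.Perm A, ∀ x : A,
    f (fun i u v => R i (σ.symm u) (σ.symm v)) (σ x) = f R x

/-- The lottery `p` is sd-efficient for the profile `R`: no lottery `q` is weakly
sd-preferred to `p` by all agents and strictly sd-preferred by some agent. -/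
def SDEfficientLottery (R : Fin n → A → A → Prop) (p : A → ℝ) : Prop :=
  ¬ ∃ q : A → ℝ, IsLottery q ∧ (∀ i, SDge (R i) q p) ∧ (∃ i, SDgt (R i) q p)

/-- sd-efficiency of a social decision scheme. -/
def SDEfficient (f : (Fin n → A → A → Prop) → (A → ℝ)) : Prop :=
  ∀ R : Fin n → A → A → Prop, IsProfile R → SDEfficientLottery R (f R)

/-- sd-strategyproofness: no agent can misreport and obtain a strictly
sd-preferred lottery. -/
def SDStrategyproof (f : (Fin n → A → A → Prop) → (A → ℝ)) : Prop :=
  ∀ R R' : Fin n → A → A → Prop, IsProfile R → IsProfile R' → ∀ i : Fin n,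
    (∀ j, j ≠ i → R j = R' j) → ¬ SDgt (R i) (f R') (f R)

/-- `x` is the unique most-preferred alternative of the relation `r`. -/
def UniqueTop (r : A → A → Prop) (x : A) : Prop :=
  ∀ y, y ≠ x → r x y ∧ ¬ r y x

/-- `f` extends random dictatorship: whenever every agent has a unique top choice,
each alternative gets probability (number of agents having it as top)/n. -/
def ExtendsRD (f : (Fin n → A → A → Prop) → (A → ℝ)) : Prop :=
  ∀ R : Fin n → A → A → Prop, IsProfile R →
    ∀ t : Fin n → A, (∀ i, UniqueTop (R i) (t i)) →
      ∀ x : A, f R x = ((univ.filter (fun i => t i = x)).card : ℝ) / (n : ℝ)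

/-- `x` is Pareto-dominated in the profile `R`. -/
def Pareto_Dominated (R : Fin n → A → A → Prop) (x : A) : Prop :=
  ∃ y : A, (∀ i, R i y x) ∧ ∃ i, R i y x ∧ ¬ R i x y

end Framework

/-! Concrete setting: alternatives `A = {a,b,c,d}` encoded as `Fin 4`. -/

/-- The alternative `a`. -/ def a : Fin 4 := 0
/-- The alternative `b`. -/ def b : Fin 4 := 1
/-- The alternative `c`. -/ def c : Fin 4 := 2
/-- The alternative `d`. -/ def d : Fin 4 := 3

/-- The weak preference relation induced by a rank function over `(a,b,c,d)`
(lower rank = more preferred; equal ranks = indifference). -/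
def pr (rk : Fin 4 → ℕ) : Fin 4 → Fin 4 → Prop := fun x y => rk x ≤ rk y


/-- The profile `R4`: ≽₁: a,{b,c,d}; ≽₂: {b,d},a,c; ≽₃: a,d,{b,c}; ≽₄: {b,c},a,d. -/
def R4 : Fin 4 → Fin 4 → Fin 4 → Prop :=
  ![pr ![0,1,1,1], pr ![1,0,2,0], pr ![0,2,2,1], pr ![1,0,0,2]]

/-- The profile `R5`: ≽₁: a,{b,c,d}; ≽₂: {b,d},a,c; ≽₃: a,{b,c,d}; ≽₄: {b,c},a,d. -/
def R5 : Fin 4 → Fin 4 → Fin 4 → Prop :=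
  ![pr ![0,1,1,1], pr ![1,0,2,0], pr ![0,1,1,1], pr ![1,0,0,2]]

/-- Moving all the probability of `x` to `y`. -/
noncomputable def moveMass {A : Type*} (p : A → ℝ) (x y : A) : A → ℝ :=
  fun w => p w + p x * ((if w = y then 1 else 0) - if w = x then 1 else 0)

lemma upperProb_moveMass {A : Type*} [Fintype A] (r : A → A → Prop) (p : A → ℝ) (x y z : A) :
    upperProb r (moveMass p x y) z =
      upperProb r p z + p x * ((if r y z then 1 else 0) - if r x z then 1 else 0) := by
  simp [upperProb, moveMass, sum_add_distrib, ← mul_sum, sum_sub_distrib]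

lemma isLottery_moveMass {A : Type*} [Fintype A] {p : A → ℝ} (hp : IsLottery p) (x y : A) :
    IsLottery (moveMass p x y) := by
  refine ⟨fun w => ?_, ?_⟩
  · have hw := hp.1 w
    have hx := hp.1 x
    unfold moveMass
    by_cases hwx : w = x
    · subst hwx
      split_ifs <;> simp [hw]
    · split_ifs <;> simp <;> linarith
  · simp [moveMass, sum_add_distrib, ← mul_sum, sum_sub_distrib, hp.2]

/-- An sd-efficient lottery gives probability zero to every Pareto-dominated alternative. -/
lemma SDEfficientLottery.eq_zero_of_pareto_dominated {A : Type*} [Fintype A] {n : ℕ}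
    {R : Fin n → A → A → Prop} {p : A → ℝ} (hR : IsProfile R) (hp : IsLottery p)
    (heff : SDEfficientLottery R p) {x : A} (hx : Pareto_Dominated R x) : p x = 0 := by
  obtain ⟨y, hy, i, -, hxi⟩ := hx
  by_contra hne
  have hpos : 0 < p x := lt_of_le_of_ne (hp.1 x) (Ne.symm hne)
  have hge : ∀ j, SDge (R j) (moveMass p x y) p := by
    intro j z
    rw [upperProb_moveMass, le_add_iff_nonneg_right]
    refine mul_nonneg hpos.le (sub_nonneg.2 ?_)
    by_cases hz : R j x z
    · simp [hz, (hR j).2 (hy j) hz]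
    · rw [if_neg hz]
      split_ifs <;> norm_num
  refine heff ⟨moveMass p x y, isLottery_moveMass hp x y, hge, i, hge i, fun h => ?_⟩
  have hyy : R i y y := by simpa using (hR i).1 y y
  have := h y
  rw [upperProb_moveMass, if_pos hyy, if_neg hxi] at this
  linarith

lemma isPref_pr (rk : Fin 4 → ℕ) : IsPref (pr rk) :=
  ⟨fun x y => le_total (rk x) (rk y), fun _ _ _ h h' => le_trans h h'⟩

lemma isProfile_R4 : IsProfile R4 := by
  intro i
  fin_cases i <;> exact isPref_pr _

lemma isProfile_R5 : IsProfile R5 := by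
  intro i
  fin_cases i <;> exact isPref_pr _

lemma pareto_dominated_R5_c : Pareto_Dominated R5 c :=
  ⟨b, fun i => by fin_cases i <;> simp [R5, pr, b, c], 1, by simp [R5, pr, b, c]⟩

lemma pareto_dominated_R5_d : Pareto_Dominated R5 d :=
  ⟨b, fun i => by fin_cases i <;> simp [R5, pr, b, d], 3, by simp [R5, pr, b, d]⟩

/-- An agent whose only strict preference is for `a` compares lotteries by the probability
of `a`. -/
lemma sdge_top_a_iff {p q : Fin 4 → ℝ} (hp : IsLottery p) (hq : IsLottery q) :
    SDge (pr ![0,1,1,1]) p q ↔ q a ≤ p a := by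
  have hp' := hp.2
  have hq' := hq.2
  rw [Fin.sum_univ_four] at hp' hq'
  simp [SDge, upperProb, sum_filter, Fin.forall_fin_succ, Fin.sum_univ_four, pr, a, hp', hq']

theorem stmt8 (f : (Fin 4 → Fin 4 → Fin 4 → Prop) → (Fin 4 → ℝ))
    (hf : IsSDS f) (han : Anonymous f) (hneu : Neutral f)
    (heff : SDEfficient f) (hsp : SDStrategyproof f) :
    f R5 c = 0 ∧ f R5 d = 0 ∧ (f R4 a > 1/2 → f R5 a > 1/2) := by
  have h4 := hf R4 isProfile_R4
  have h5 := hf R5 isProfile_R5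
  have hE := heff R5 isProfile_R5
  refine ⟨hE.eq_zero_of_pareto_dominated isProfile_R5 h5 pareto_dominated_R5_c,
    hE.eq_zero_of_pareto_dominated isProfile_R5 h5 pareto_dominated_R5_d, fun ha => ?_⟩
  have hsp3 := hsp R5 R4 isProfile_R5 isProfile_R4 2 (fun j hj => by
    fin_cases j <;> first | rfl | exact absurd rfl hj)
  have hR : R5 2 = pr ![0,1,1,1] := rfl
  rw [hR, SDgt, sdge_top_a_iff h4 h5, sdge_top_a_iff h5 h4] at hsp3
  by_contra hlt
  exact hsp3 ⟨by linarith, by linarith⟩
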